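/- For every t > 0 and x ∈ ℝ, the Barenblatt function 𝒰 is smooth at (t,x) and satisfies the fast diffusion equation classically: ∂_t 𝒰(t,x) = ∂²_{xx}(𝒰(t,x)^m). -/

import Mathlib

open MeasureTheory Real Set

/-- The constant k̃ = (1-m)/(2(m+1)m). -/
noncomputable def ktilde (m : ℝ) : ℝ := (1 - m) / (2 * (m + 1) * m)

/-- The constant I = ∫_{-π/2}^{π/2} (cos x)^{2m/(1-m)} dx. -/
noncomputable def Iconst (m : ℝ) : ℝ := ∫ x in (-(π/2))..(π/2), Real.cos x ^ (2*m/(1-m))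

/-- The constant D = (I/√k̃)^{2(1-m)/(m+1)}. -/
noncomputable def Dconst (m : ℝ) : ℝ := (Iconst m / Real.sqrt (ktilde m)) ^ (2*(1-m)/(m+1))

/-- The Barenblatt function 𝒰(t,x) = t^{-α}(D + k̃ x² t^{-2α})^{-1/(1-m)}, α = 1/(m+1). -/
noncomputable def barenblatt (m t x : ℝ) : ℝ :=
  t ^ (-(1/(m+1))) * (Dconst m + ktilde m * x^2 * t ^ (-(2*(1/(m+1))))) ^ (-(1/(1-m)))

theorem ktilde_pos {m : ℝ} (hm : m ∈ Set.Ioo (0:ℝ) 1) : 0 < ktilde m := by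
  have h0 := hm.1
  have h1 : 0 < 1 - m := sub_pos.2 hm.2
  unfold ktilde
  positivity

theorem Iconst_pos {m : ℝ} (hm : m ∈ Set.Ioo (0:ℝ) 1) : 0 < Iconst m := by
  have h0 := hm.1
  have h1 : 0 < 1 - m := sub_pos.2 hm.2
  unfold Iconst
  apply intervalIntegral.intervalIntegral_pos_of_pos_on
  · apply Continuous.intervalIntegrable
    exact Real.continuous_cos.rpow_const fun _ => Or.inr (by positivity)
  · intro x hx
    exact Real.rpow_pos_of_pos (Real.cos_pos_of_mem_Ioo hx) _
  · linarith [Real.pi_pos]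

theorem Dconst_pos {m : ℝ} (hm : m ∈ Set.Ioo (0:ℝ) 1) : 0 < Dconst m :=
  Real.rpow_pos_of_pos (div_pos (Iconst_pos hm) (Real.sqrt_pos.2 (ktilde_pos hm))) _

/-- The base `D + k̃ x² t^{-2α}` of the Barenblatt profile is positive. -/
theorem barenblatt_base_pos {m t : ℝ} (hm : m ∈ Set.Ioo (0:ℝ) 1) (ht : 0 < t) (x : ℝ) :
    0 < Dconst m + ktilde m * x^2 * t ^ (-(2*(1/(m+1)))) := by
  have hD := Dconst_pos hm
  have hk := ktilde_pos hm
  positivity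

theorem contDiffAt_barenblatt {m t : ℝ} (hm : m ∈ Set.Ioo (0:ℝ) 1) (ht : 0 < t) (x : ℝ) :
    ContDiffAt ℝ (⊤ : ℕ∞) (fun q : ℝ × ℝ => barenblatt m q.1 q.2) (t, x) := by
  unfold barenblatt
  have hpow (p : ℝ) : ContDiffAt ℝ (⊤ : ℕ∞) (fun q : ℝ × ℝ => q.1 ^ p) (t, x) :=
    contDiffAt_fst.rpow_const_of_ne ht.ne'
  exact (hpow _).mul (ContDiffAt.rpow_const_of_ne
    (contDiffAt_const.add ((contDiffAt_const.mul (contDiffAt_snd.pow 2)).mul (hpow _)))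
    (barenblatt_base_pos hm ht x).ne')

theorem hasDerivAt_barenblatt_base {m t : ℝ} (x : ℝ) :
    HasDerivAt (fun y => Dconst m + ktilde m * y^2 * t ^ (-(2*(1/(m+1)))))
      (2 * ktilde m * x * t ^ (-(2*(1/(m+1))))) x := by
  have h := (((hasDerivAt_pow 2 x).const_mul (ktilde m)).mul_const
    (t ^ (-(2*(1/(m+1)))))).const_add (Dconst m)
  exact h.congr_deriv (by push_cast; ring)

/-- The flux of the Barenblatt function: `∂ₓ(𝒰^m) = -α x 𝒰 / t`. -/
theorem hasDerivAt_barenblatt_rpow {m t : ℝ} (hm : m ∈ Set.Ioo (0:ℝ) 1) (ht : 0 < t) (x : ℝ) :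
    HasDerivAt (fun y => barenblatt m t y ^ m) (-(1/(m+1)) * x * barenblatt m t x / t) x := by
  have h0 := hm.1
  have h1 : 0 < 1 - m := sub_pos.2 hm.2
  have hF := barenblatt_base_pos hm ht
  have hfun : (fun y => barenblatt m t y ^ m) = fun y => t ^ (-(1/(m+1)) * m) *
      (Dconst m + ktilde m * y^2 * t ^ (-(2*(1/(m+1))))) ^ (-(1/(1-m)) * m) := by
    funext y
    unfold barenblatt
    rw [Real.mul_rpow (by positivity) (Real.rpow_nonneg (hF y).le _),
      ← Real.rpow_mul ht.le, ← Real.rpow_mul (hF y).le]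
  rw [hfun]
  have h := ((hasDerivAt_barenblatt_base (m := m) (t := t) x).rpow_const
    (p := -(1/(1-m)) * m) (Or.inl (hF x).ne')).const_mul (t ^ (-(1/(m+1)) * m))
  refine h.congr_deriv ?_
  have he : -(1/(1-m)) * m - 1 = -(1/(1-m)) := by field_simp; ring
  have ht' : t ^ (-(1/(m+1)) * m) * t ^ (-(2*(1/(m+1)))) = t ^ (-(1/(m+1))) / t := by
    rw [← Real.rpow_add ht, ← Real.rpow_sub_one ht.ne']
    congr 1
    field_simp
    ring
  have hc : 2 * ktilde m * (-(1/(1-m)) * m) = -(1/(m+1)) := by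
    unfold ktilde
    field_simp
  rw [he]
  unfold barenblatt
  set G := (Dconst m + ktilde m * x^2 * t ^ (-(2*(1/(m+1))))) ^ (-(1/(1-m)))
  linear_combination (2 * ktilde m * (-(1/(1-m)) * m) * x * G) * ht' +
    (x * G * (t ^ (-(1/(m+1))) / t)) * hc

theorem hasDerivAt_barenblatt_space {m t : ℝ} (hm : m ∈ Set.Ioo (0:ℝ) 1) (ht : 0 < t) (x : ℝ) :
    HasDerivAt (barenblatt m t)
      (t ^ (-(1/(m+1))) * (2 * ktilde m * x * t ^ (-(2*(1/(m+1)))) * (-(1/(1-m))) *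
        (Dconst m + ktilde m * x^2 * t ^ (-(2*(1/(m+1))))) ^ (-(1/(1-m)) - 1))) x :=
  ((hasDerivAt_barenblatt_base x).rpow_const
    (Or.inl (barenblatt_base_pos hm ht x).ne')).const_mul _

/-- Self-similarity in infinitesimal form: `∂ₜ𝒰 = -(α/t) (𝒰 + x ∂ₓ𝒰)`. -/
theorem hasDerivAt_barenblatt_time {m t : ℝ} (hm : m ∈ Set.Ioo (0:ℝ) 1) (ht : 0 < t) (x : ℝ) :
    HasDerivAt (fun s => barenblatt m s x)
      (-(1/(m+1)) / t * (barenblatt m t x + x * deriv (barenblatt m t) x)) t := by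
  rw [(hasDerivAt_barenblatt_space hm ht x).deriv]
  have hpow (p : ℝ) : HasDerivAt (fun s : ℝ => s ^ p) (p * t ^ (p - 1)) t :=
    Real.hasDerivAt_rpow_const (Or.inl ht.ne')
  have h := (hpow (-(1/(m+1)))).mul
    ((((hpow (-(2*(1/(m+1))))).const_mul (ktilde m * x^2)).const_add (Dconst m)).rpow_const
      (p := -(1/(1-m))) (Or.inl (barenblatt_base_pos hm ht x).ne'))
  refine h.congr_deriv ?_
  unfold barenblatt
  rw [Real.rpow_sub_one ht.ne', Real.rpow_sub_one ht.ne']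
  ring

/-- the Barenblatt function is smooth at every (t,x) with t > 0 and solves
the fast diffusion equation ∂_t 𝒰 = ∂²_{xx}(𝒰^m) classically there. -/
theorem barenblatt_smooth_and_classical_solution
    (m : ℝ) (hm : m ∈ Set.Ioo (0:ℝ) 1) (t x : ℝ) (ht : 0 < t) :
    ContDiffAt ℝ (⊤ : ℕ∞) (fun q : ℝ × ℝ => barenblatt m q.1 q.2) (t, x) ∧
    deriv (fun s => barenblatt m s x) t
      = deriv (deriv (fun y => barenblatt m t y ^ m)) x := by
  refine ⟨contDiffAt_barenblatt hm ht x, ?_⟩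
  have hflux : deriv (fun y => barenblatt m t y ^ m) =
      fun y => -(1/(m+1)) * y * barenblatt m t y / t :=
    funext fun y => (hasDerivAt_barenblatt_rpow hm ht y).deriv
  have hx := (hasDerivAt_barenblatt_space hm ht x).differentiableAt.hasDerivAt
  have h := (((hasDerivAt_id' x).const_mul (-(1/(m+1)))).mul hx).div_const t
  rw [hflux, (hasDerivAt_barenblatt_time hm ht x).deriv]
  refine Eq.trans ?_ h.deriv.symm
  ring
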